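/- In the dual Ellentuck topology on (ω)^ω, every meager set is nowhere dense; consequently, no nonempty open set is meager (the dual Ellentuck topology is a Baire topology). -/

import Mathlib

namespace DualRamsey

/-- A partition: a set of pairwise disjoint nonempty blocks (subsets of ℕ). -/
def IsPartition (P : Set (Set ℕ)) : Prop :=
  (∀ b ∈ P, b.Nonempty) ∧ ∀ b ∈ P, ∀ c ∈ P, b ≠ c → Disjoint b c

/-- The domain of a partition: the union of its blocks. -/
def pdom (P : Set (Set ℕ)) : Set ℕ := ⋃₀ P

/-- Membership in (ω)^ω : an infinite partition of ℕ. -/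
def InfPart (X : Set (Set ℕ)) : Prop :=
  IsPartition X ∧ pdom X = Set.univ ∧ X.Infinite

/-- Membership in (ℕ) : a partition whose domain is {0, …, n−1} for some n. -/
def FinPart (s : Set (Set ℕ)) : Prop :=
  IsPartition s ∧ ∃ n : ℕ, pdom s = Set.Iio n

/-- `Coarser P Q` means P ⊑ Q : P is coarser than Q, i.e. every block p of P satisfies
that p ∩ dom(Q) is a union of sets of the form q ∩ dom(P) with q a block of Q. -/
def Coarser (P Q : Set (Set ℕ)) : Prop :=
  ∀ p ∈ P, ∃ S ⊆ Q, p ∩ pdom Q = ⋃ q ∈ S, q ∩ pdom P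

/-- `Segment s X` means s ⪯ X : for every block p of s there is a block q of X
with p = q ∩ dom(s). -/
def Segment (s X : Set (Set ℕ)) : Prop :=
  ∀ p ∈ s, ∃ q ∈ X, p = q ∩ pdom s

/-- For s ∈ (ℕ) with dom(s) = {0,…,n−1}, this is the number n. -/
noncomputable def finBound (s : Set (Set ℕ)) : ℕ := sInf {n | pdom s = Set.Iio n}

/-- s* := s ∪ {{n}} where dom(s) = {0,…,n−1}. -/
noncomputable def sStar (s : Set (Set ℕ)) : Set (Set ℕ) := insert {finBound s} s

/-- The dual Ellentuck neighbourhood (s,X) := {Y ∈ (ω)^ω : s ⪯ Y and Y ⊑ X}. -/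
def EllNbhd (s X : Set (Set ℕ)) : Set (Set (Set ℕ)) :=
  {Y | InfPart Y ∧ Segment s Y ∧ Coarser Y X}

/-- (s,X)^n := {u ∈ (ℕ) : |u| = n, s ⪯ u, u* ⊑ X}. -/
def nseg (s X : Set (Set ℕ)) (n : ℕ) : Set (Set (Set ℕ)) :=
  {u | FinPart u ∧ u.ncard = n ∧ Segment s u ∧ Coarser (sStar u) X}

/-- (s,ω)^n := {u ∈ (ℕ) : |u| = n, s ⪯ u} (ω viewed as the partition into singletons). -/
def nsegOmega (s : Set (Set ℕ)) (n : ℕ) : Set (Set (Set ℕ)) :=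
  {u | FinPart u ∧ u.ncard = n ∧ Segment s u}

/-- a and b lie in a common block of P. -/
def sameBlock (P : Set (Set ℕ)) (a b : ℕ) : Prop := ∃ p ∈ P, a ∈ p ∧ b ∈ p

/-- P ⊓ Q : the finest partition coarser than both P and Q, with
dom(P ⊓ Q) = dom(P) ∪ dom(Q); its blocks are the classes of the equivalence
relation generated by "lying in a common block of P or of Q". -/
def pmeet (P Q : Set (Set ℕ)) : Set (Set ℕ) :=
  {b | ∃ a ∈ pdom P ∪ pdom Q,
    b = {c | Relation.EqvGen (fun u v => sameBlock P u v ∨ sameBlock Q u v) a c}}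

/-- P ⊑* Q : P is almost coarser than Q, i.e. there is a partition R with finite
domain such that R ⊓ P ⊑ Q. -/
def AlmostCoarser (P Q : Set (Set ℕ)) : Prop :=
  ∃ R, IsPartition R ∧ (pdom R).Finite ∧ Coarser (pmeet R P) Q

/-- A filter on (ω)^ω. -/
structure IsPFilter (F : Set (Set (Set ℕ))) : Prop where
  mem_infPart : ∀ X ∈ F, InfPart X
  empty_not_mem : ∅ ∉ F
  upward : ∀ X ∈ F, ∀ Y, InfPart Y → Coarser X Y → Y ∈ F
  meet_infPart : ∀ X ∈ F, ∀ Y ∈ F, InfPart (pmeet X Y)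
  meet_mem : ∀ X ∈ F, ∀ Y ∈ F, pmeet X Y ∈ F

/-- An ultrafilter on (ω)^ω : a filter not properly contained in any other filter. -/
def IsPUltrafilter (F : Set (Set (Set ℕ))) : Prop :=
  IsPFilter F ∧ ∀ G, IsPFilter G → F ⊆ G → F = G

/-- The segment colouring property. -/
def HasSCP (F : Set (Set (Set ℕ))) : Prop :=
  ∀ s, FinPart s → ∀ X ∈ F, Coarser s X → ∀ k r : ℕ, 1 ≤ s.ncard + k → 1 ≤ r →
    ∀ π : Set (Set ℕ) → ℕ, (∀ u ∈ nseg s X (s.ncard + k), π u < r) →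
      ∃ Y ∈ EllNbhd s X, Y ∈ F ∧
        ∀ u ∈ nseg s Y (s.ncard + k), ∀ v ∈ nseg s Y (s.ncard + k), π u = π v

/-- `IsLCondWith E p s Xw` : p is an L*_E-condition with stem s and witness family Xw. -/
def IsLCondWith (E : Set (Set (Set ℕ))) (p : Set (Set (Set ℕ))) (s : Set (Set ℕ))
    (Xw : Set (Set ℕ) → Set (Set ℕ)) : Prop :=
  (∀ t ∈ p, FinPart t) ∧
  s ∈ p ∧ (∀ t ∈ p, Segment s t) ∧
  (∀ t ∈ p, Xw t ∈ E) ∧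
  (∀ t ∈ p, Coarser (sStar t) (Xw t)) ∧
  (∀ t ∈ p, {u | u ∈ p ∧ Segment t u ∧ u.ncard = t.ncard + 1}
      = nseg (sStar t) (Xw t) (t.ncard + 1)) ∧
  (∀ t ∈ p, ∀ u ∈ p, Segment t u → EllNbhd u (Xw u) ⊆ EllNbhd t (Xw t)) ∧
  (∀ t ∈ p, ∀ u ∈ p, pdom t = pdom u → Coarser t u → Xw t = Xw u)

/-- X is a branch of the condition p with stem s. -/
def IsBranch (p : Set (Set (Set ℕ))) (s : Set (Set ℕ)) (X : Set (Set ℕ)) : Prop :=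
  ∀ t, FinPart t → Segment s t → Coarser (sStar t) X → t ∈ p

/-- F is diagonalizable: every L*_F-condition has a branch in F. -/
def Diagonalizable (F : Set (Set (Set ℕ))) : Prop :=
  ∀ p s Xw, IsLCondWith F p s Xw → ∃ X ∈ F, IsBranch p s X

/-- A Ramsey* ultrafilter: a diagonalizable scp-filter. -/
def RamseyStar (F : Set (Set (Set ℕ))) : Prop :=
  IsPFilter F ∧ HasSCP F ∧ Diagonalizable F

/-- O is F-open: a union of nonempty dual Ellentuck neighbourhoods (s,X) with X ∈ F. -/
def FOpen (F O : Set (Set (Set ℕ))) : Prop :=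
  ∃ I : Set ((Set (Set ℕ)) × (Set (Set ℕ))),
    (∀ q ∈ I, FinPart q.1 ∧ q.2 ∈ F ∧ (EllNbhd q.1 q.2).Nonempty) ∧
    O = ⋃ q ∈ I, EllNbhd q.1 q.2

/-- (s,X) is good with respect to the F-open set O. -/
def FGood (F O : Set (Set (Set ℕ))) (s X : Set (Set ℕ)) : Prop :=
  ∃ Y ∈ EllNbhd s X, Y ∈ F ∧ EllNbhd s Y ⊆ O

/-- (s,X) is ugly with respect to O: (t*,X) is bad for every t ∈ (ℕ) with
s ⪯ t*, t* ⊑ X and |t| = |s|. -/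
def FUgly (F O : Set (Set (Set ℕ))) (s X : Set (Set ℕ)) : Prop :=
  ∀ t, FinPart t → Segment s (sStar t) → Coarser (sStar t) X → t.ncard = s.ncard →
    ¬ FGood F O (sStar t) X

/-- p is uniform with uniformity witness X (X = cu(p)). -/
def UniformWith (F : Set (Set (Set ℕ))) (p : Set (Set (Set ℕ)))
    (Xw : Set (Set ℕ) → Set (Set ℕ)) (X : Set (Set ℕ)) : Prop :=
  X ∈ F ∧ ∀ t ∈ p, EllNbhd t X = EllNbhd t (Xw t)

/-- (X) := {Y ∈ (ω)^ω : Y ⊑ X}. -/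
def coarsenings (X : Set (Set ℕ)) : Set (Set (Set ℕ)) :=
  {Y | InfPart Y ∧ Coarser Y X}

/-- A ⊆ (ω)^ω has the dual Ramsey property. -/
def IsDualRamsey (A : Set (Set (Set ℕ))) : Prop :=
  ∃ X, InfPart X ∧ (coarsenings X ⊆ A ∨ coarsenings X ∩ A = ∅)

/-- A ⊆ (ω)^ω is completely dual Ramsey. -/
def CompletelyDualRamsey (A : Set (Set (Set ℕ))) : Prop :=
  ∀ s X, FinPart s → InfPart X → (EllNbhd s X).Nonempty →
    ∃ Y ∈ EllNbhd s X, (EllNbhd s Y ⊆ A ∨ EllNbhd s Y ∩ A = ∅)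

/- ### Coding between reals and partitions -/

/-- The hypotheses on the fixed pairing function ♭ : it is (induced by) a bijection
between two-element subsets of ℕ and ℕ. -/
def FlatBijection (flat : ℕ → ℕ → ℕ) : Prop :=
  (∀ m n, flat m n = flat n m) ∧
  (∀ a b c d, a ≠ b → c ≠ d → flat a b = flat c d → ({a, b} : Set ℕ) = {c, d}) ∧
  (∀ k, ∃ a b, a ≠ b ∧ flat a b = k)

/-- trans(x): the codes ♭({a,b}) of pairs {a,b} connected by a finite chain through x. -/
def ptrans (flat : ℕ → ℕ → ℕ) (x : Set ℕ) : Set ℕ :=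
  {k | ∃ m : ℕ, ∃ f : ℕ → ℕ, 1 ≤ m ∧ f 0 ≠ f m ∧ k = flat (f 0) (f m) ∧
    ∀ i < m, flat (f i) (f (i + 1)) ∈ x}

/-- The equivalence relation n ∼ m iff n = m or ♭({n,m}) ∈ trans(x). -/
def cpRel (flat : ℕ → ℕ → ℕ) (x : Set ℕ) (n m : ℕ) : Prop :=
  n = m ∨ flat n m ∈ ptrans flat x

/-- cp(x): the partition of ℕ whose blocks are the classes of cpRel. -/
def cp (flat : ℕ → ℕ → ℕ) (x : Set ℕ) : Set (Set ℕ) :=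
  {b | ∃ n : ℕ, b = {m | cpRel flat x n m}}

/-- pc(X): the partition code of X. -/
def pcode (flat : ℕ → ℕ → ℕ) (X : Set (Set ℕ)) : Set ℕ :=
  {k | ∃ n m, n ≠ m ∧ sameBlock X n m ∧ k = flat n m}

/- ### The game G_F -/

/-- A move of player I: a pair ⟨t, Y⟩. -/
abbrev MoveI := (Set (Set ℕ)) × (Set (Set ℕ))

/-- The play (t, Y, X) follows the strategy σ of player I (σ reads off the
previous moves of player II). -/
def Follows (σ : List (Set (Set ℕ)) → MoveI) (t Y X : ℕ → Set (Set ℕ)) : Prop :=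
  ∀ n, σ (List.ofFn fun i : Fin n => X i) = (t n, Y n)

/-- Player I's n-th move in the play (t,Y,X) is legal. -/
def LegalI (F : Set (Set (Set ℕ))) (t Y X : ℕ → Set (Set ℕ)) (n : ℕ) : Prop :=
  FinPart (t n) ∧ Y n ∈ F ∧ (EllNbhd (sStar (t n)) (Y n)).Nonempty ∧
  ∀ m, n = m + 1 →
    Segment (sStar (t m)) (sStar (t n)) ∧ Coarser (sStar (t n)) (X m) ∧
    (t n).ncard = (t m).ncard + 1

/-- Player II's n-th move in the play (t,Y,X) is legal. -/
def LegalII (F : Set (Set (Set ℕ))) (t Y X : ℕ → Set (Set ℕ)) (n : ℕ) : Prop :=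
  X n ∈ F ∧ X n ∈ EllNbhd (sStar (t n)) (Y n)

/-- σ is a winning strategy for player I in G_F: against legal play of II it always
produces legal moves, and in every legal play following σ player I wins, i.e. any
Y ∈ (ω)^ω with t_n ⪯ Y for all n is not in F. -/
def WinningStratI (F : Set (Set (Set ℕ))) (σ : List (Set (Set ℕ)) → MoveI) : Prop :=
  ∀ t Y X, Follows σ t Y X →
    (∀ n, (∀ m < n, LegalII F t Y X m) → LegalI F t Y X n) ∧
    ((∀ n, LegalII F t Y X n) →
      ∀ Z, InfPart Z → (∀ n, Segment (t n) Z) → Z ∉ F)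

/-- A game filter: an ultrafilter such that player I has no winning strategy in G_F. -/
def GameFilter (F : Set (Set (Set ℕ))) : Prop :=
  IsPUltrafilter F ∧ ∀ σ, ¬ WinningStratI F σ

/- ### Density notions for the appendix -/

/-- (t)^0_s := {u ∈ (ℕ) : dom(u) = dom(t), s ⪯ u, u ⊑ t, |u| = |s|}. -/
def iseg0 (s t : Set (Set ℕ)) : Set (Set (Set ℕ)) :=
  {u | FinPart u ∧ pdom u = pdom t ∧ Segment s u ∧ Coarser u t ∧ u.ncard = s.ncard}

/-- K ⊆ (ℕ) is dense in (t,X): for every Y ∈ (t,X) ∩ F there is u ∈ K with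
t ⪯ u* and u* ⊑ Y. -/
def DenseIn (F : Set (Set (Set ℕ))) (K : Set (Set (Set ℕ))) (t X : Set (Set ℕ)) : Prop :=
  ∀ Y ∈ EllNbhd t X, Y ∈ F → ∃ u ∈ K, Segment t (sStar u) ∧ Coarser (sStar u) Y

/-- D is 0-dense in (X)^{0*}_s: for every Y ∈ (s,X) ∩ F there is u ∈ D with
s ⪯ u* and u* ⊑ Y. -/
def ZeroDense (F : Set (Set (Set ℕ))) (D : Set (Set (Set ℕ))) (s X : Set (Set ℕ)) : Prop :=
  ∀ Y ∈ EllNbhd s X, Y ∈ F → ∃ u ∈ D, Segment s (sStar u) ∧ Coarser (sStar u) Y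

/-- (t,X)^{k*}_s := {u ∈ (ℕ) : t ⪯ u*, u* ⊑ X, |u| = |s| + k}. -/
def tseg (s t X : Set (Set ℕ)) (k : ℕ) : Set (Set (Set ℕ)) :=
  {u | FinPart u ∧ Segment t (sStar u) ∧ Coarser (sStar u) X ∧ u.ncard = s.ncard + k}

/-- E is k-dense in (t,X)^{k*}_s: for every Y ∈ (t,X) ∩ F, (t,Y)^{k*}_s ∩ E ≠ ∅. -/
def KDense (F : Set (Set (Set ℕ))) (E : Set (Set (Set ℕ))) (s t X : Set (Set ℕ))
    (k : ℕ) : Prop :=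
  ∀ Y ∈ EllNbhd t X, Y ∈ F → (tseg s t Y k ∩ E).Nonempty

/-- The space (ω)^ω of infinite partitions of ℕ. -/
def PartNat := {X : Set (Set ℕ) // InfPart X}

/-- The dual Ellentuck topology: the topology generated by the dual Ellentuck
neighbourhoods (s,X) as basic open sets. -/
def dualEllentuckTopology : TopologicalSpace PartNat :=
  TopologicalSpace.generateFrom
    {S | ∃ s X, FinPart s ∧ InfPart X ∧ S = {Y : PartNat | Y.1 ∈ EllNbhd s X}}

/-! ### The Carlson–Simpson theorem on left variable words -/

section CarlsonSimpson

attribute [local instance] Ultrafilter.semigroup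

/-- The ultrafilters on a semigroup have a left ideal that is generated by each of its elements. -/
theorem exists_minimal_left_ideal (S : Type*) [Semigroup S] [Nonempty S] :
    ∃ I : Set (Ultrafilter S), I.Nonempty ∧ (∀ u, ∀ v ∈ I, u * v ∈ I) ∧
      ∀ v ∈ I, ∀ w ∈ I, ∃ u, u * v = w := by
  let F : Set (Set (Ultrafilter S)) :=
    {N | IsClosed N ∧ N.Nonempty ∧ ∀ u, ∀ v ∈ N, u * v ∈ N}
  obtain ⟨I, hI⟩ : ∃ I, Minimal (· ∈ F) I := by
    refine zorn_superset _ fun c hcs hc => ?_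
    refine ⟨⋂₀ c, ⟨isClosed_sInter fun t ht => (hcs ht).1, ?_, fun u v hv t ht =>
      (hcs ht).2.2 u v (hv t ht)⟩, fun s hs => Set.sInter_subset_of_mem hs⟩
    obtain rfl | hne := c.eq_empty_or_nonempty
    · rw [Set.sInter_empty]
      exact Set.univ_nonempty
    have := hne.coe_sort
    rw [Set.sInter_eq_iInter]
    exact IsCompact.nonempty_iInter_of_directed_nonempty_isCompact_isClosed _
      (DirectedOn.directed_val (IsChain.directedOn hc.symm)) (fun i => (hcs i.prop).2.1)
      (fun i => (hcs i.prop).1.isCompact) (fun i => (hcs i.prop).1)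
  obtain ⟨-, hne, hmul⟩ := hI.prop
  refine ⟨I, hne, hmul, fun v hv w hw => ?_⟩
  have hrange : Set.range (· * v) = I := by
    refine hI.eq_of_subset ⟨(isCompact_range (Ultrafilter.continuous_mul_left v)).isClosed,
      Set.range_nonempty _, ?_⟩ ?_
    · rintro u _ ⟨t, rfl⟩
      exact ⟨u * t, mul_assoc _ _ _⟩
    · rintro _ ⟨t, rfl⟩
      exact hmul t v hv
  rw [← hrange] at hw
  exact hw

/-- Pushing ultrafilters forward along a homomorphism is multiplicative. -/
theorem ultrafilter_map_mul {S T : Type*} [Semigroup S] [Semigroup T] (φ : S →ₙ* T)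
    (u v : Ultrafilter S) : (u * v).map φ = u.map φ * v.map φ :=
  Ultrafilter.coe_inj.mp <| Filter.ext' fun p => by
    simp [Ultrafilter.eventually_mul, Filter.eventually_map]

/-- Substitution of the letter `a` for the variable `none`. -/
def substVar {A : Type*} (a : A) : FreeMonoid (Option A) →* FreeMonoid A :=
  FreeMonoid.map fun o => o.getD a

/-- There is an ultrafilter on left variable words all of whose substitutions absorb one another. -/
theorem exists_leftVariable_ultrafilter (A : Type*) :
    ∃ r : Ultrafilter (FreeMonoid (Option A)),
      {y | ∃ z, y = FreeMonoid.of none * z} ∈ r ∧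
      ∀ a b, r.map (substVar a) * r.map (substVar b) = r.map (substVar a) := by
  obtain ⟨I, ⟨p, hp⟩, hI, hgen⟩ := exists_minimal_left_ideal (FreeMonoid A)
  let L : Set (FreeMonoid (Option A)) := {y | ∃ z, y = FreeMonoid.of none * z}
  let q : Ultrafilter (FreeMonoid (Option A)) := p.map (FreeMonoid.map some)
  have hL : ∀ u v : Ultrafilter (FreeMonoid (Option A)), L ∈ u → L ∈ u * v := by
    intro u v hu
    change ∀ᶠ m in u, ∀ᶠ m' in v, m * m' ∈ L
    filter_upwards [hu] with m hm
    obtain ⟨z, rfl⟩ := hm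
    exact Filter.Eventually.of_forall fun m' => ⟨z * m', mul_assoc _ _ _⟩
  obtain ⟨r, ⟨l, hl, rfl⟩, hr⟩ := exists_idempotent_in_compact_subsemigroup
    (fun r => Ultrafilter.continuous_mul_left r) ((· * q) '' {u | L ∈ u})
    (Set.Nonempty.image _ ⟨pure (FreeMonoid.of none),
      show FreeMonoid.of none ∈ L from ⟨1, (mul_one _).symm⟩⟩)
    ((ultrafilter_isClosed_basic L).isCompact.image (Ultrafilter.continuous_mul_left q))
    (by
      rintro _ ⟨u, hu, rfl⟩ _ ⟨v, hv, rfl⟩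
      exact ⟨u * q * v, hL _ _ (hL _ _ hu), mul_assoc _ _ _⟩)
  refine ⟨l * q, hL _ _ hl, fun a b => ?_⟩
  have hq : ∀ a, q.map (substVar a) = p := fun a => by
    have : (substVar a) ∘ (FreeMonoid.map some : FreeMonoid A →* _) = id := by
      funext w
      simp [substVar, FreeMonoid.map_map]
    rw [Ultrafilter.map_map, this, Ultrafilter.map_id]
  have hmem : ∀ a, (l * q).map (substVar a) ∈ I := fun a => by
    have := ultrafilter_map_mul (substVar a).toMulHom l q
    change _ = _ * q.map (substVar a) at this
    rw [hq] at this
    exact this ▸ hI _ _ hp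
  have hidem : ∀ a, (l * q).map (substVar a) * (l * q).map (substVar a)
      = (l * q).map (substVar a) := fun a => by
    have := ultrafilter_map_mul (substVar a).toMulHom (l * q) (l * q)
    rw [hr] at this
    exact this.symm
  obtain ⟨u, hu⟩ := hgen _ (hmem b) _ (hmem a)
  rw [← hu, mul_assoc, hidem]

/-- **Carlson–Simpson**: the words obtained from suitable left variable words by substitution
all get the same colour. The set of words using the first `n` of the variable words is `G n`. -/
theorem carlson_simpson {A : Type*} [Finite A] [Nonempty A] (c : FreeMonoid A → Prop) :
    ∃ (w₀ : FreeMonoid A) (z : ℕ → FreeMonoid (Option A)) (G : ℕ → Set (FreeMonoid A)),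
      w₀ ∈ G 0 ∧
      (∀ n, ∀ w ∈ G n, ∀ a, w * substVar a (FreeMonoid.of none * z n) ∈ G (n + 1)) ∧
      ((∀ n, ∀ w ∈ G n, c w) ∨ ∀ n, ∀ w ∈ G n, ¬ c w) := by
  obtain ⟨r, hr, habs⟩ := exists_leftVariable_ultrafilter A
  let E : A → Ultrafilter (FreeMonoid A) := fun a => r.map (substVar a)
  let a₀ : A := Classical.arbitrary A
  obtain ⟨C, hC, hcol⟩ : ∃ C : FreeMonoid A → Prop, (∀ᶠ w in E a₀, C w) ∧
      ((∀ w, C w → c w) ∨ ∀ w, C w → ¬ c w) := by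
    rcases (E a₀).em c with h | h
    · exact ⟨c, h, Or.inl fun _ => id⟩
    · exact ⟨_, h, Or.inr fun _ => id⟩
  have hext : ∀ a, ∀ v, (∀ᶠ w in E a, C (v * w)) →
      ∀ b, ∀ᶠ w in E a, ∀ᶠ w' in E b, C (v * w * w') := by
    intro a v h b
    have h' : ∀ᶠ w in ↑(E a * E b), C (v * w) := by
      rwa [show E a * E b = E a from habs a b]
    rw [Ultrafilter.eventually_mul] at h'
    simpa only [mul_assoc] using h'
  let P : FreeMonoid A → Prop := fun w => C w ∧ ∀ a, ∀ᶠ v in E a, C (w * v)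
  have hstart : ∃ w, P w := by
    have h : ∀ᶠ w in E a₀, ∀ b, ∀ᶠ w' in E b, C (w * w') := by
      rw [Filter.eventually_all]
      intro b
      simpa using hext a₀ 1 (by simpa using hC) b
    exact (hC.and h).exists
  have hstep : ∀ G : {G : Set (FreeMonoid A) // G.Finite ∧ ∀ w ∈ G, P w},
      ∃ z, ∀ w ∈ G.1, ∀ a, P (w * substVar a (FreeMonoid.of none * z)) := by
    rintro ⟨G, hfin, hG⟩
    have h : ∀ᶠ y in r, ∀ w ∈ G, ∀ a, P (w * substVar a y) := by
      rw [Filter.eventually_all_finite hfin]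
      intro w hw
      rw [Filter.eventually_all]
      intro a
      have h1 : ∀ᶠ v in E a, P (w * v) :=
        ((hG w hw).2 a).and (Filter.eventually_all.2 fun b => hext a w ((hG w hw).2 a) b)
      exact h1
    obtain ⟨y, hy, z, rfl⟩ := (h.and hr).exists
    exact ⟨z, hy⟩
  choose z hz using hstep
  obtain ⟨w₀, hw₀⟩ := hstart
  let next : {G : Set (FreeMonoid A) // G.Finite ∧ ∀ w ∈ G, P w} →
      {G : Set (FreeMonoid A) // G.Finite ∧ ∀ w ∈ G, P w} := fun G =>
    ⟨Set.image2 (fun w a => w * substVar a (FreeMonoid.of none * z G)) G.1 Set.univ,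
      G.2.1.image2 _ Set.finite_univ, by
        rintro _ ⟨w, hw, a, -, rfl⟩
        exact hz G w hw a⟩
  let G : ℕ → {G : Set (FreeMonoid A) // G.Finite ∧ ∀ w ∈ G, P w} := fun n =>
    next^[n] ⟨{w₀}, Set.finite_singleton _, by rintro _ rfl; exact hw₀⟩
  refine ⟨w₀, fun n => z (G n), fun n => (G n).1, rfl, fun n w hw a => ?_, ?_⟩
  · simp only [G, Function.iterate_succ_apply']
    exact ⟨w, hw, a, trivial, rfl⟩
  · exact hcol.imp (fun h n w hw => h w ((G n).2.2 w hw).1) fun h n w hw => h w ((G n).2.2 w hw).1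

end CarlsonSimpson

/-! ### Rigid surjections -/

/-- `f` is a surjection of `ℕ` in which new values appear in increasing order, and it fixes
every number below `m`. -/
structure RigidFix (m : ℕ) (f : ℕ → ℕ) : Prop where
  init : ∀ n, ∀ j < f n, ∃ i < n, f i = j
  surj : Function.Surjective f
  fix : ∀ i < m, f i = i

/-- The values of `f` on the first `n` numbers are exactly the numbers below `m`. -/
structure IsCut (f : ℕ → ℕ) (n m : ℕ) : Prop where
  lt : ∀ i < n, f i < m
  hit : ∀ j < m, ∃ i < n, f i = j

namespace RigidFix

variable {m n : ℕ} {f g : ℕ → ℕ}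

theorem id (m : ℕ) : RigidFix m id :=
  ⟨fun _ j hj => ⟨j, hj, rfl⟩, Function.surjective_id, fun _ _ => rfl⟩

theorem comp (hg : RigidFix m g) (hf : RigidFix m f) : RigidFix m (g ∘ f) where
  init n j hj := by
    obtain ⟨i, hi, rfl⟩ := hg.init _ j hj
    obtain ⟨k, hk, rfl⟩ := hf.init _ i hi
    exact ⟨k, hk, rfl⟩
  surj := hg.surj.comp hf.surj
  fix i hi := by simp [hf.fix i hi, hg.fix i hi]

theorem mono (hf : RigidFix m f) (h : n ≤ m) : RigidFix n f :=
  ⟨hf.init, hf.surj, fun i hi => hf.fix i (hi.trans_le h)⟩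

theorem zero (hf : RigidFix m f) : RigidFix 0 f := hf.mono m.zero_le

theorem apply_le (hf : RigidFix m f) (n : ℕ) : f n ≤ n := by
  induction n using Nat.strong_induction_on with
  | _ n ih =>
    by_contra! h
    obtain ⟨i, hi, h'⟩ := hf.init n n h
    have := ih i hi
    omega

/-- The first occurrence of a value. -/
theorem exists_first (hf : RigidFix m f) (k : ℕ) :
    ∃ n, f n = k ∧ IsCut f n k := by
  classical
  have hex : ∃ n, f n = k := hf.surj k
  refine ⟨Nat.find hex, Nat.find_spec hex, fun i hi => ?_, fun j hj => ?_⟩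
  · by_contra! h
    rcases h.eq_or_lt with h | h
    · exact Nat.find_min hex hi h.symm
    · obtain ⟨i', hi', h'⟩ := hf.init i k h
      exact Nat.find_min hex (hi'.trans hi) h'
  · exact hf.init _ j (by rwa [Nat.find_spec hex])

end RigidFix

namespace IsCut

variable {m n : ℕ} {f g : ℕ → ℕ}

theorem congr (h : IsCut f n m) (hfg : ∀ i < n, g i = f i) : IsCut g n m := by
  refine ⟨fun i hi => hfg i hi ▸ h.lt i hi, fun j hj => ?_⟩
  obtain ⟨i, hi, rfl⟩ := h.hit j hj
  exact ⟨i, hi, hfg i hi⟩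

theorem unique {m' : ℕ} (h : IsCut f n m) (h' : IsCut f n m') : m = m' := by
  rcases lt_trichotomy m m' with hlt | heq | hlt
  · obtain ⟨i, hi, e⟩ := h'.hit m hlt
    have := h.lt i hi
    omega
  · exact heq
  · obtain ⟨i, hi, e⟩ := h.hit m' hlt
    have := h'.lt i hi
    omega

theorem le (h : IsCut f n m) {k : ℕ} (hf : RigidFix k f) : m ≤ n := by
  by_contra! hlt
  obtain ⟨i, hi, e⟩ := h.hit n hlt
  have := hf.apply_le i
  omega

end IsCut

/-- Keep the first `n` values of `f` and continue with `m, m + 1, …`. -/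
def freshExt (f : ℕ → ℕ) (n m : ℕ) (i : ℕ) : ℕ := if i < n then f i else i - n + m

section freshExt

variable {k m n : ℕ} {f g : ℕ → ℕ}

theorem freshExt_of_lt {i : ℕ} (h : i < n) : freshExt f n m i = f i := if_pos h

theorem freshExt_of_not_lt {i : ℕ} (h : ¬ i < n) : freshExt f n m i = i - n + m := if_neg h

theorem RigidFix.freshExt (hf : RigidFix k f) (hc : IsCut f n m) (hkn : k ≤ n) :
    RigidFix k (freshExt f n m) where
  init i j hj := by
    unfold DualRamsey.freshExt at hj ⊢
    split_ifs at hj with hi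
    · obtain ⟨i', hi', rfl⟩ := hf.init i j hj
      exact ⟨i', hi', if_pos (hi'.trans hi)⟩
    · by_cases hjm : j < m
      · obtain ⟨i', hi', rfl⟩ := hc.hit j hjm
        exact ⟨i', by omega, if_pos hi'⟩
      · refine ⟨j - m + n, by omega, ?_⟩
        rw [if_neg (by omega)]
        omega
  surj j := by
    unfold DualRamsey.freshExt
    by_cases hjm : j < m
    · obtain ⟨i', hi', rfl⟩ := hc.hit j hjm
      exact ⟨i', if_pos hi'⟩
    · refine ⟨j - m + n, ?_⟩
      rw [if_neg (by omega)]
      omega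
  fix i hi := by
    rw [DualRamsey.freshExt, if_pos (hi.trans_le hkn), hf.fix i hi]

/-- A rigid surjection factors through the fresh extension of any of its initial parts. -/
theorem RigidFix.exists_factor (hg : RigidFix k g) (hc : IsCut f n m)
    (hfg : ∀ i < n, g i = f i) : ∃ l, RigidFix m l ∧ g = l ∘ DualRamsey.freshExt f n m := by
  refine ⟨fun i => if i < m then i else g (i - m + n), ⟨fun i j hj => ?_, fun j => ?_,
    fun i hi => if_pos hi⟩, ?_⟩
  · split_ifs at hj with hi
    · exact ⟨j, hj, if_pos (hj.trans hi)⟩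
    · obtain ⟨i', hi', rfl⟩ := hg.init _ j hj
      by_cases hn : i' < n
      · have := hc.lt i' hn
        rw [← hfg i' hn] at this
        exact ⟨g i', by omega, if_pos this⟩
      · refine ⟨i' - n + m, by omega, ?_⟩
        rw [if_neg (by omega), show i' - n + m - m + n = i' by omega]
  · obtain ⟨i, rfl⟩ := hg.surj j
    by_cases hn : i < n
    · have := hc.lt i hn
      rw [← hfg i hn] at this
      exact ⟨g i, if_pos this⟩
    · refine ⟨i - n + m, ?_⟩
      rw [if_neg (by omega), show i - n + m - m + n = i by omega]
  · funext i
    by_cases hn : i < n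
    · rw [Function.comp_apply, freshExt_of_lt hn, if_pos (hc.lt i hn), hfg i hn]
    · rw [Function.comp_apply, freshExt_of_not_lt hn, if_neg (by omega), show i - n + m - m + n = i by omega]

/-- A rigid surjection acting after a fresh extension lifts to one acting before it. -/
theorem IsCut.exists_lift (hc : IsCut f n m) {q : ℕ → ℕ} (hq : RigidFix m q) :
    ∃ h, RigidFix n h ∧ freshExt f n m ∘ h = q ∘ freshExt f n m := by
  choose! s hs hfs using hc.hit
  refine ⟨fun i => if i < n then i else
    if q (i - n + m) < m then s (q (i - n + m)) else q (i - n + m) - m + n,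
    ⟨fun i j hj => ?_, fun j => ?_, fun i hi => if_pos hi⟩, ?_⟩
  · by_cases hjn : j < n
    · by_cases hi : i < n
      · rw [if_pos hi] at hj
        exact ⟨j, hj, if_pos hjn⟩
      · exact ⟨j, by omega, if_pos hjn⟩
    · have hi : ¬ i < n := fun hi => by rw [if_pos hi] at hj; omega
      rw [if_neg hi] at hj
      have hqm : ¬ q (i - n + m) < m := fun h => by
        rw [if_pos h] at hj
        have := hs _ h
        omega
      rw [if_neg hqm] at hj
      obtain ⟨i', hi', e⟩ := hq.init (i - n + m) (j - n + m) (by omega)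
      have him : ¬ i' < m := fun h => by
        have := hq.fix i' h
        omega
      refine ⟨i' - m + n, by omega, ?_⟩
      rw [if_neg (by omega), show i' - m + n - n + m = i' by omega, e, if_neg (by omega)]
      omega
  · by_cases hjn : j < n
    · exact ⟨j, if_pos hjn⟩
    · obtain ⟨i', e⟩ := hq.surj (j - n + m)
      have him : ¬ i' < m := fun h => by
        have := hq.fix i' h
        omega
      refine ⟨i' - m + n, ?_⟩
      rw [if_neg (by omega), show i' - m + n - n + m = i' by omega, e, if_neg (by omega)]
      omega
  · funext i
    simp only [Function.comp, freshExt]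
    by_cases hn : i < n
    · rw [if_pos hn, if_pos hn, hq.fix _ (hc.lt i hn)]
    · simp only [if_neg hn]
      by_cases hqm : q (i - n + m) < m
      · rw [if_pos hqm, if_pos (hs _ hqm), hfs _ hqm]
      · rw [if_neg hqm, if_neg (by omega)]
        omega

end freshExt

/-! ### Fusion -/

/-- Infinite compositions of rigid surjections fixing more and more numbers. -/
theorem exists_infinite_comp {m : ℕ} {k : ℕ → ℕ → ℕ} (hk : ∀ j, RigidFix (m + j) (k j)) :
    ∃ l : ℕ → ℕ → ℕ, (∀ j, RigidFix (m + j) (l j)) ∧ ∀ j, l j = l (j + 1) ∘ k j := by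
  -- `c j i` is the composition of `i` factors starting with `k j`.
  let c : ℕ → ℕ → ℕ → ℕ := fun j i => Nat.rec id (fun t f => k (j + t) ∘ f) i
  have c_succ : ∀ j i, c j (i + 1) = k (j + i) ∘ c j i := fun j i => rfl
  have c_succ' : ∀ j i, c j (i + 1) = c (j + 1) i ∘ k j := by
    intro j i
    induction i with
    | zero => rfl
    | succ i ih =>
      rw [c_succ, ih, c_succ, Function.comp_assoc, show j + (i + 1) = j + 1 + i by omega]
  have c_rigid : ∀ j i, RigidFix (m + j) (c j i) := by
    intro j i
    induction i with
    | zero => exact RigidFix.id _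
    | succ i ih => exact ((hk (j + i)).mono (by omega)).comp ih
  have c_stable : ∀ j x i, ∀ i' ≥ i, c j i x < m + j + i → c j i' x = c j i x := by
    intro j x i i' hi' hx
    induction i', hi' using Nat.le_induction with
    | base => rfl
    | succ i' hi' ih =>
      rw [c_succ, Function.comp_apply, ih]
      exact (hk _).fix _ (by omega)
  let l : ℕ → ℕ → ℕ := fun j x => c j (x + 1) x
  have hl : ∀ j x, ∀ i > x, c j i x = l j x := fun j x i hi =>
    c_stable j x (x + 1) i hi (by have := (c_rigid j (x + 1)).apply_le x; omega)
  refine ⟨l, fun j => ⟨fun n v hv => ?_, fun v => ?_, fun i hi => (c_rigid j (i + 1)).fix i hi⟩,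
    fun j => ?_⟩
  · obtain ⟨i, hi, e⟩ := (c_rigid j (n + 1)).init n v hv
    exact ⟨i, hi, by rw [← hl j i (n + 1) (by omega), e]⟩
  · obtain ⟨x, hx⟩ := (c_rigid j (v + 1)).surj v
    refine ⟨x, ?_⟩
    have := c_stable j x (v + 1) (max (v + 1) (x + 1)) (le_max_left _ _) (by omega)
    rw [← hl j x (max (v + 1) (x + 1)) (by omega), this, hx]
  · funext x
    have := (hk j).apply_le x
    rw [Function.comp_apply, ← hl (j + 1) (k j x) (x + 1) (by omega),
      ← hl j x (x + 2) (by omega), c_succ', Function.comp_apply]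

/-- A property of pairs `(m, Z)` that persists under, and can be achieved by, rigid surjections
fixing `m`. -/
structure IsDenseHereditary (R : ℕ → (ℕ → ℕ) → Prop) : Prop where
  hereditary : ∀ m Z k, RigidFix m k → R m Z → R m (k ∘ Z)
  dense : ∀ m Z, RigidFix 0 Z → ∃ h, RigidFix m h ∧ R m (h ∘ Z)

theorem IsDenseHereditary.exists_step {R : ℕ → (ℕ → ℕ) → Prop} (hR : IsDenseHereditary R)
    (n : ℕ) {Z : ℕ → ℕ} (hZ : RigidFix 0 Z) :
    ∃ k, RigidFix n k ∧ ∀ m g, RigidFix 0 g → IsCut g n m → R m (g ∘ k ∘ Z) := by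
  classical
  suffices H : ∀ T : Finset (Fin n → Fin n), ∃ k, RigidFix n k ∧ ∀ m g, RigidFix 0 g →
      IsCut g n m → (∃ p ∈ T, ∀ i : Fin n, g i = p i) → R m (g ∘ k ∘ Z) by
    obtain ⟨k, hk, h⟩ := H Finset.univ
    exact ⟨k, hk, fun m g hg hc => h m g hg hc
      ⟨fun i => ⟨g i, (hg.apply_le i).trans_lt i.2⟩, Finset.mem_univ _, fun _ => rfl⟩⟩
  intro T
  induction T using Finset.induction_on with
  | empty => exact ⟨id, RigidFix.id n, by simp⟩
  | insert p T _ ih =>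
    obtain ⟨k, hk, ih⟩ := ih
    by_cases hex : ∃ m f, RigidFix 0 f ∧ IsCut f n m ∧ ∀ i : Fin n, f i = p i
    · obtain ⟨m, f, hf, hc, hfp⟩ := hex
      obtain ⟨q, hq, hRq⟩ := hR.dense m (freshExt f n m ∘ k ∘ Z)
        ((hf.freshExt hc (Nat.zero_le n)).comp (hk.zero.comp hZ))
      obtain ⟨h, hh, hlift⟩ := hc.exists_lift hq
      refine ⟨h ∘ k, hh.comp hk, fun m' g hg hc' hgT => ?_⟩
      obtain ⟨p', hp', hgp⟩ := hgT
      rcases Finset.mem_insert.1 hp' with rfl | hp'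
      · have hgf : ∀ i < n, g i = f i := fun i hi => (hgp ⟨i, hi⟩).trans (hfp ⟨i, hi⟩).symm
        obtain rfl : m' = m := hc'.unique (hc.congr hgf)
        obtain ⟨l, hl, rfl⟩ := hg.exists_factor hc hgf
        have := hR.hereditary _ _ l hl hRq
        rw [← Function.comp_assoc q, ← hlift] at this
        exact this
      · have hgh : ∀ i < n, (g ∘ h) i = g i := fun i hi => by simp [hh.fix i hi]
        exact ih m' (g ∘ h) (hg.comp hh.zero) (hc'.congr hgh)
          ⟨p', hp', fun i => (hgh i i.2).trans (hgp i)⟩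
    · refine ⟨k, hk, fun m g hg hc hgT => ?_⟩
      obtain ⟨p', hp', hgp⟩ := hgT
      rcases Finset.mem_insert.1 hp' with rfl | hp'
      · exact absurd ⟨m, g, hg, hc, hgp⟩ hex
      · exact ih m g hg hc ⟨p', hp', hgp⟩

/-- A dense hereditary property can be achieved simultaneously for all coarsenings. -/
theorem IsDenseHereditary.exists_fusion {R : ℕ → (ℕ → ℕ) → Prop} (hR : IsDenseHereditary R)
    (m : ℕ) {Y : ℕ → ℕ} (hY : RigidFix 0 Y) :
    ∃ h, RigidFix m h ∧ ∀ m' ≥ m, ∀ g, RigidFix 0 g → R m' (g ∘ h ∘ Y) := by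
  choose K hK hKR using fun (n : ℕ) (Z : {Z : ℕ → ℕ // RigidFix 0 Z}) => hR.exists_step n Z.2
  let Z : ℕ → {Z : ℕ → ℕ // RigidFix 0 Z} := fun j => Nat.rec ⟨Y, hY⟩
    (fun i W => ⟨K (m + i) W ∘ W.1, (hK (m + i) W).zero.comp W.2⟩) j
  have hZ : ∀ j, (Z (j + 1)).1 = K (m + j) (Z j) ∘ (Z j).1 := fun j => rfl
  obtain ⟨l, hl, hlk⟩ := exists_infinite_comp (m := m) (k := fun j => K (m + j) (Z j))
    fun j => hK (m + j) (Z j)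
  have hlZ : ∀ j, l 0 ∘ Y = l j ∘ (Z j).1 := by
    intro j
    induction j with
    | zero => rfl
    | succ j ih => rw [ih, hlk j, hZ, Function.comp_assoc]
  refine ⟨l 0, hl 0, fun m' hm' g hg => ?_⟩
  obtain ⟨n, -, hc⟩ := hg.exists_first m'
  obtain ⟨j, rfl⟩ := Nat.exists_eq_add_of_le (hm'.trans (hc.le hg))
  rw [hlZ (j + 1), hZ]
  exact hKR (m + j) (Z j) m' (g ∘ l (j + 1)) (hg.comp (hl (j + 1)).zero)
    (hc.congr fun i hi => by simp [(hl (j + 1)).fix i (by omega)])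

/-! ### The pigeonhole principle for rigid surjections -/

/-- An increasing sequence of finite words, the `n`-th of which is followed by the fresh letter
`m + n`, has a rigid surjection as its limit. -/
theorem exists_rigidFix_of_words {m : ℕ} {u v : ℕ → List ℕ} {w : List ℕ}
    (hw : ∀ x ∈ w, x < m) (hu₀ : u 0 = List.range m ++ w)
    (hu : ∀ n, u (n + 1) = u n ++ (m + n) :: v n) (hv : ∀ n, ∀ x ∈ v n, x < m ∨ x = m + n) :
    ∃ h, RigidFix m h ∧ ∀ n i x : ℕ, (u n)[i]? = some x → h i = x := by
  have hlen : ∀ n, m + n ≤ (u n).length := by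
    intro n
    induction n with
    | zero => simp [hu₀]
    | succ n ih =>
      rw [hu, List.length_append, List.length_cons]
      omega
  have hstable : ∀ n i x : ℕ, (u n)[i]? = some x → ∀ N ≥ n, (u N)[i]? = some x := by
    intro n i x hx N hN
    induction N, hN using Nat.le_induction with
    | base => exact hx
    | succ N _ ih =>
      rw [hu, List.getElem?_append_left (List.getElem?_eq_some_iff.1 ih).1, ih]
  let h : ℕ → ℕ := fun i => (u (i + 1))[i]?.getD 0
  have hspec : ∀ n i x : ℕ, (u n)[i]? = some x → h i = x := by
    intro n i x hx
    have hi : i < (u (i + 1)).length := by have := hlen (i + 1); omega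
    have h₁ := hstable _ _ _ hx (max n (i + 1)) (le_max_left _ _)
    have h₂ := hstable _ _ _ (List.getElem?_eq_getElem hi) (max n (i + 1)) (le_max_right _ _)
    rw [h₁] at h₂
    simp only [h, List.getElem?_eq_getElem hi, ← h₂, Option.getD_some]
  have hfix : ∀ i < m, h i = i := fun i hi => hspec 0 i i (by
    rw [hu₀, List.getElem?_append_left (by simpa using hi), List.getElem?_range hi])
  have hfresh : ∀ n, h (u n).length = m + n := fun n => hspec (n + 1) _ _ (by simp [hu])
  have hlt : ∀ n k, n < k → (u n).length < (u k).length := by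
    intro n k hk
    induction k, hk using Nat.le_induction with
    | base => simp [hu]
    | succ k _ ih => rw [hu k, List.length_append, List.length_cons]; omega
  have hhit : ∀ n, ∀ j < m + n, ∃ i < (u n).length, h i = j := by
    intro n j hj
    by_cases hjm : j < m
    · exact ⟨j, by have := hlen n; omega, hfix j hjm⟩
    · exact ⟨(u (j - m)).length, hlt _ _ (by omega), by rw [hfresh]; omega⟩
  have hinit : ∀ n, ∀ i < (u n).length, ∀ j < h i, ∃ i' < i, h i' = j := by
    intro n
    induction n with
    | zero =>
      intro i hi j hj
      by_cases him : i < m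
      · rw [hfix i him] at hj
        exact ⟨j, hj, hfix j (hj.trans him)⟩
      · have hx := List.getElem?_eq_getElem hi
        have hval := hspec 0 i _ hx
        rw [← hval, hu₀, List.getElem?_append_right (by simpa using him)] at hx
        have := hw _ (List.mem_of_getElem? hx)
        exact ⟨j, by omega, hfix j (by omega)⟩
    | succ n ih =>
      intro i hi j hj
      by_cases hin : i < (u n).length
      · exact ih i hin j hj
      · have hx := List.getElem?_eq_getElem hi
        have hval := hspec (n + 1) i _ hx
        rw [← hval, hu, List.getElem?_append_right (by omega)] at hx
        have hle : h i ≤ m + n := by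
          rcases List.mem_cons.1 (List.mem_of_getElem? hx) with h | h
          · omega
          · have := hv n _ h
            omega
        obtain ⟨i', hi', e⟩ := hhit n j (by omega)
        exact ⟨i', by omega, e⟩
  refine ⟨h, ⟨fun i j hj => hinit (i + 1) i (by have := hlen (i + 1); omega) j hj, fun j => ?_,
    hfix⟩, hspec⟩
  obtain ⟨i, -, e⟩ := hhit (j + 1) j (by omega)
  exact ⟨i, e⟩

/-- The values of `g` between `m` and the first occurrence of `m` spell out the word `w`. -/
def HasWord (m : ℕ) (g : ℕ → ℕ) (w : List (Fin m)) : Prop :=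
  (∀ i (hi : i < w.length), g (m + i) = w[i]) ∧ g (m + w.length) = m

theorem HasWord.isCut {m : ℕ} {g : ℕ → ℕ} {w : List (Fin m)} (h : HasWord m g w)
    (hg : RigidFix m g) : IsCut g (m + w.length + 1) (m + 1) := by
  refine ⟨fun i hi => ?_, fun j hj => ?_⟩
  · by_cases him : i < m
    · rw [hg.fix i him]
      omega
    · obtain ⟨i, rfl⟩ := Nat.exists_eq_add_of_le (not_lt.1 him)
      rcases (show i ≤ w.length by omega).lt_or_eq with hi' | rfl
      · have := w[i].2
        rw [h.1 i hi']
        omega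
      · rw [h.2]
        omega
  · rcases (show j ≤ m by omega).lt_or_eq with hj' | rfl
    · exact ⟨j, by omega, hg.fix j hj'⟩
    · exact ⟨j + w.length, by omega, h.2⟩

theorem HasWord.apply_eq {m : ℕ} {g g' : ℕ → ℕ} {w : List (Fin m)} (h : HasWord m g w)
    (h' : HasWord m g' w) (hg : RigidFix m g) (hg' : RigidFix m g') :
    ∀ i < m + w.length + 1, g' i = g i := by
  intro i hi
  by_cases him : i < m
  · rw [hg.fix i him, hg'.fix i him]
  · obtain ⟨i, rfl⟩ := Nat.exists_eq_add_of_le (not_lt.1 him)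
    rcases (show i ≤ w.length by omega).lt_or_eq with hi' | rfl
    · rw [h.1 i hi', h'.1 i hi']
    · rw [h.2, h'.2]

/-- A property of rigid surjections fixing `m` that depends only on the values before the first
occurrence of `m` is constant on the coarsenings of some rigid surjection. -/
theorem exists_rigidFix_monochromatic (m : ℕ) (c : (ℕ → ℕ) → Prop)
    (hc : ∀ g k, RigidFix m g → RigidFix (m + 1) k → (c (k ∘ g) ↔ c g)) :
    ∃ h, RigidFix m h ∧
      ((∀ g, RigidFix m g → c (g ∘ h)) ∨ ∀ g, RigidFix m g → ¬ c (g ∘ h)) := by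
  rcases m.eq_zero_or_pos with rfl | hm
  · refine ⟨id, RigidFix.id 0, ?_⟩
    have h : ∀ g, RigidFix 0 g → (c (g ∘ id) ↔ c id) := fun g hg => hc id g (RigidFix.id 0)
      ⟨hg.init, hg.surj, fun i hi => by have := hg.apply_le i; omega⟩
    by_cases hid : c id
    · exact Or.inl fun g hg => (h g hg).2 hid
    · exact Or.inr fun g hg => fun hcg => hid ((h g hg).1 hcg)
  have : Nonempty (Fin m) := ⟨⟨0, hm⟩⟩
  have hword : ∀ {g g' w}, HasWord m g w → HasWord m g' w → RigidFix m g → RigidFix m g' →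
      (c g ↔ c g') := by
    intro g g' w h h' hg hg'
    have hcut := h.isCut hg
    have hext := hg.freshExt hcut (by omega)
    obtain ⟨l, hl, e⟩ := hg.exists_factor hcut fun _ _ => rfl
    obtain ⟨l', hl', e'⟩ := hg'.exists_factor hcut (h.apply_eq h' hg hg')
    have h₁ := hc _ _ hext hl
    have h₂ := hc _ _ hext hl'
    rw [← e] at h₁
    rw [← e'] at h₂
    exact h₁.trans h₂.symm
  obtain ⟨w₀, z, G, hw₀, hG, hcol⟩ := carlson_simpson (A := Fin m)
    fun w => ∃ g, RigidFix m g ∧ HasWord m g (FreeMonoid.toList w) ∧ c g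
  let v : ℕ → List ℕ := fun n =>
    (FreeMonoid.toList (z n)).map fun o => o.elim (m + n) Fin.val
  let u : ℕ → List ℕ := fun n => Nat.rec
    (List.range m ++ (FreeMonoid.toList w₀).map Fin.val) (fun k l => l ++ (m + k) :: v k) n
  have hu : ∀ n, u (n + 1) = u n ++ (m + n) :: v n := fun n => rfl
  obtain ⟨h, hh, hspec⟩ := exists_rigidFix_of_words (m := m) (u := u) (v := v)
    (w := (FreeMonoid.toList w₀).map Fin.val) (by simp) rfl hu (by
      intro n x hx
      obtain ⟨o, -, rfl⟩ := List.mem_map.1 hx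
      cases o with
      | none => exact Or.inr rfl
      | some a => exact Or.inl a.2)
  have hmap : ∀ g, RigidFix m g → ∀ n, (∀ j < n, g (m + j) < m) →
      ∃ w ∈ G n, (u n).map g = List.range m ++ (FreeMonoid.toList w).map Fin.val := by
    intro g hg n
    induction n with
    | zero =>
      refine fun _ => ⟨w₀, hw₀, ?_⟩
      change (List.range m ++ (FreeMonoid.toList w₀).map Fin.val).map g = _
      rw [List.map_append, List.map_map]
      congr 1
      · exact (List.map_congr_left fun i hi => hg.fix i (List.mem_range.1 hi)).trans
          (List.map_id _)
      · exact List.map_congr_left fun a _ => hg.fix a a.2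
    | succ n ih =>
      intro hn
      obtain ⟨w, hw, e⟩ := ih fun j hj => hn j (by omega)
      refine ⟨_, hG n w hw ⟨g (m + n), hn n (by omega)⟩, ?_⟩
      rw [hu, List.map_append, e, List.append_assoc]
      congr 1
      simp only [substVar, map_mul, FreeMonoid.toList_mul, List.map_append, FreeMonoid.map_of,
        FreeMonoid.toList_of, List.map_cons, Option.getD_none, FreeMonoid.toList_map, List.map_map,
        v, List.cons_append, List.nil_append]
      congr 2
      refine List.map_congr_left fun o _ => ?_
      cases o with
      | none => rfl
      | some a => exact hg.fix a a.2
  have hgh : ∀ g, RigidFix m g → ∃ n, ∃ w ∈ G n, HasWord m (g ∘ h) (FreeMonoid.toList w) := by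
    intro g hg
    obtain ⟨k, hk, hcut⟩ := hg.exists_first m
    obtain ⟨n, rfl⟩ := Nat.exists_eq_add_of_le (hcut.le hg)
    obtain ⟨w, hw, e⟩ := hmap g hg n fun j hj => hcut.lt _ (by omega)
    have hlen : (u n).length = m + (FreeMonoid.toList w).length := by
      simpa using congrArg List.length e
    refine ⟨n, w, hw, fun i hi => ?_, ?_⟩
    · have hi' : m + i < (u n).length := by omega
      have h₁ : ((u n).map g)[m + i]? = some (g (h (m + i))) := by
        rw [List.getElem?_map, hspec n _ _ (List.getElem?_eq_getElem hi'),
          List.getElem?_eq_getElem hi', Option.map_some]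
      rw [e, List.getElem?_append_right (by simp)] at h₁
      simpa [hi, eq_comm] using h₁
    · rw [← hlen, Function.comp_apply, hspec (n + 1) _ (m + n) (by simp [hu]), hk]
  refine ⟨h, hh, hcol.imp (fun H g hg => ?_) fun H g hg hcg => ?_⟩
  · obtain ⟨n, w, hw, hgw⟩ := hgh g hg
    obtain ⟨g', hg', hgw', hcg'⟩ := H n w hw
    exact (hword hgw hgw' (hg.comp hh) hg').2 hcg'
  · obtain ⟨n, w, hw, hgw⟩ := hgh g hg
    exact H n w hw ⟨_, hg.comp hh, hgw, hcg⟩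

/-! ### Dense open sets of rigid surjections -/

/-- A set of rigid surjections that is open and dense for the sets `{g ∘ Y | RigidFix m g}`. -/
structure IsDenseOpen (D : (ℕ → ℕ) → Prop) : Prop where
  isOpen : ∀ f, RigidFix 0 f → D f → ∃ m, ∀ g, RigidFix m g → D (g ∘ f)
  dense : ∀ m f, RigidFix 0 f → ∃ g, RigidFix m g ∧ D (g ∘ f)

theorem IsDenseOpen.isDenseHereditary {D : (ℕ → ℕ) → Prop} (hD : IsDenseOpen D) :
    IsDenseHereditary fun m Z => ∀ g, RigidFix m g → D (g ∘ Z) := by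
  let In : ℕ → (ℕ → ℕ) → Prop := fun m Z => ∀ g, RigidFix m g → D (g ∘ Z)
  let Bad : ℕ → (ℕ → ℕ) → Prop := fun m Z => ∀ h, RigidFix m h → ¬ In m (h ∘ Z)
  have hIn : ∀ {m Z k}, RigidFix m k → In m Z → In m (k ∘ Z) :=
    fun hk hZ g hg => hZ _ (hg.comp hk)
  have hBad : ∀ {m Z k}, RigidFix m k → Bad m Z → Bad m (k ∘ Z) :=
    fun hk hZ g hg => hZ _ (hg.comp hk)
  have hdecide : IsDenseHereditary fun m Z => In m Z ∨ Bad m Z := by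
    refine ⟨fun m Z k hk h => h.imp (hIn hk) (hBad hk), fun m Z _ => ?_⟩
    by_cases hb : Bad m Z
    · exact ⟨id, RigidFix.id m, Or.inr hb⟩
    · simp only [Bad, not_forall, not_not] at hb
      obtain ⟨h, hh, hin⟩ := hb
      exact ⟨h, hh, Or.inl hin⟩
  have hpropagate :
      IsDenseHereditary fun m Z => In m Z ∨ ∀ g, RigidFix m g → Bad (m + 1) (g ∘ Z) := by
    refine ⟨fun m Z k hk h => h.imp (hIn hk) fun H g hg => H _ (hg.comp hk), fun m Z hZ => ?_⟩
    obtain ⟨h, hh, hdec⟩ := hdecide.exists_fusion m hZ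
    obtain ⟨k, hk, hall | hall⟩ := exists_rigidFix_monochromatic m
      (fun g => In (m + 1) (g ∘ h ∘ Z)) (by
        refine fun g l hg hl => ⟨fun hin => ?_, fun hin => hIn (Z := g ∘ h ∘ Z) hl hin⟩
        exact (hdec (m + 1) (by omega) g hg.zero).resolve_right fun hb => hb l hl hin)
    · exact ⟨k ∘ h, hk.comp hh, Or.inl fun g hg => hall g hg id (RigidFix.id _)⟩
    · exact ⟨k ∘ h, hk.comp hh, Or.inr fun g hg =>
        (hdec (m + 1) (by omega) (g ∘ k) (hg.comp hk).zero).resolve_left (hall g hg)⟩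
  refine ⟨fun m Z k hk => hIn hk, fun m Y hY => ?_⟩
  obtain ⟨h, hh, hprop⟩ := hpropagate.exists_fusion m hY
  refine ⟨h, hh, by_contra fun hnot => ?_⟩
  have hbad : ∀ j, ∀ g, RigidFix m g → Bad (m + j + 1) (g ∘ h ∘ Y) := by
    intro j
    induction j with
    | zero => exact (hprop m le_rfl id (RigidFix.id 0)).resolve_left hnot
    | succ j ih =>
      intro g hg
      exact (hprop (m + j + 1) (by omega) g hg.zero).resolve_left
        (ih g hg id (RigidFix.id _)) id (RigidFix.id _)
  obtain ⟨g, hg, hDg⟩ := hD.dense m (h ∘ Y) (hh.zero.comp hY)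
  obtain ⟨k, hk⟩ := hD.isOpen _ (hg.zero.comp (hh.zero.comp hY)) hDg
  exact hbad k g hg id (RigidFix.id _) fun l hl => hk l (hl.mono (by omega))

/-- Countably many dense open sets have a common basic open set below any given one. -/
theorem IsDenseOpen.exists_forall {D : ℕ → (ℕ → ℕ) → Prop} (hD : ∀ n, IsDenseOpen (D n))
    (m : ℕ) {Y : ℕ → ℕ} (hY : RigidFix 0 Y) :
    ∃ h, RigidFix m h ∧ ∀ g, RigidFix m g → ∀ n, D n (g ∘ h ∘ Y) := by
  have hR : IsDenseHereditary fun k Z => ∀ n ≤ k, ∀ g, RigidFix k g → D n (g ∘ Z) := by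
    refine ⟨fun k Z l hl h n hn => (hD n).isDenseHereditary.hereditary k Z l hl (h n hn),
      fun k Z hZ => ?_⟩
    suffices H : ∀ N, ∃ h, RigidFix k h ∧ ∀ n < N, ∀ g, RigidFix k g → D n (g ∘ h ∘ Z) by
      obtain ⟨h, hh, H⟩ := H (k + 1)
      exact ⟨h, hh, fun n hn => H n (by omega)⟩
    intro N
    induction N with
    | zero => exact ⟨id, RigidFix.id k, by simp⟩
    | succ N ih =>
      obtain ⟨h, hh, ih⟩ := ih
      obtain ⟨l, hl, H⟩ := (hD N).isDenseHereditary.dense k (h ∘ Z) (hh.zero.comp hZ)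
      refine ⟨l ∘ h, hl.comp hh, fun n hn => ?_⟩
      rcases (show n ≤ N by omega).lt_or_eq with hn' | rfl
      · exact (hD n).isDenseHereditary.hereditary k _ l hl (ih n hn')
      · exact H
  obtain ⟨h, hh, H⟩ := hR.exists_fusion m hY
  exact ⟨h, hh, fun g hg n => H (max m n) (le_max_left _ _) g hg.zero n (le_max_right _ _) id
    (RigidFix.id _)⟩

/-! ### Partitions and rigid surjections -/

/-- The partition of `ℕ` into the fibres of `f`. -/
def fibres (f : ℕ → ℕ) : Set (Set ℕ) := Set.range fun n => f ⁻¹' {n}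

theorem pdom_fibres (f : ℕ → ℕ) : pdom (fibres f) = Set.univ :=
  Set.eq_univ_of_forall fun a => ⟨_, ⟨f a, rfl⟩, rfl⟩

theorem RigidFix.infPart_fibres {f : ℕ → ℕ} (hf : RigidFix 0 f) : InfPart (fibres f) := by
  refine ⟨⟨?_, ?_⟩, pdom_fibres f, Set.infinite_range_of_injective fun a b hab => ?_⟩
  · rintro _ ⟨n, rfl⟩
    exact hf.surj n
  · rintro _ ⟨n, rfl⟩ _ ⟨k, rfl⟩ hne
    refine Set.disjoint_left.2 fun a ha hb => hne ?_
    rw [Set.mem_preimage, Set.mem_singleton_iff] at ha hb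
    rw [← ha, ← hb]
  · obtain ⟨x, rfl⟩ := hf.surj a
    exact (Set.ext_iff.1 hab x).1 rfl

/-- Every infinite partition of `ℕ` consists of the fibres of a rigid surjection. -/
theorem InfPart.exists_fibres {X : Set (Set ℕ)} (hX : InfPart X) :
    ∃ f, RigidFix 0 f ∧ X = fibres f := by
  classical
  obtain ⟨⟨hne, hdisj⟩, hdom, hinf⟩ := hX
  have hex : ∀ a, ∃ b ∈ X, a ∈ b := fun a => by
    have : a ∈ pdom X := hdom ▸ Set.mem_univ a
    exact this
  choose B hB ha using hex
  have hBeq : ∀ b ∈ X, ∀ a ∈ b, B a = b := fun b hb a hab => by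
    by_contra h
    exact Set.disjoint_left.1 (hdisj _ (hB a) _ hb h) (ha a) hab
  let r : ℕ → ℕ := fun a => sInf (B a)
  have hr : ∀ a, r a ∈ B a := fun a => Nat.sInf_mem ⟨a, ha a⟩
  have hBr : ∀ a, B (r a) = B a := fun a => hBeq _ (hB a) _ (hr a)
  have hrr : ∀ a, r (r a) = r a := fun a => congrArg sInf (hBr a)
  have hra : ∀ a, r a ≤ a := fun a => Nat.sInf_le (ha a)
  let p : ℕ → Prop := fun a => r a = a
  have hpinf : (Set.ofPred p).Infinite := by
    intro hfin
    refine hinf ((hfin.image B).subset fun b hb => ?_)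
    obtain ⟨a, hab⟩ := hne b hb
    exact ⟨r a, hrr a, (hBr a).trans (hBeq b hb a hab)⟩
  have hnth : ∀ j, r (Nat.nth p j) = Nat.nth p j := fun j => Nat.nth_mem_of_infinite hpinf j
  let f : ℕ → ℕ := fun a => Nat.count p (r a)
  have hfnth : ∀ j, f (Nat.nth p j) = j := fun j => by
    simp only [f, hnth, Nat.count_nth_of_infinite hpinf]
  have hfB : ∀ a b, f a = f b ↔ B a = B b := fun a b => by
    refine ⟨fun h => ?_, fun h => by simp only [f, r, h]⟩
    rw [← hBr a, ← hBr b, Nat.count_injective (p := p) (hrr a) (hrr b) h]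
  refine ⟨f, ⟨fun n j hj => ⟨Nat.nth p j, (Nat.nth_lt_of_lt_count hj).trans_le (hra n), hfnth j⟩,
    fun j => ⟨_, hfnth j⟩, fun i hi => absurd hi (Nat.not_lt_zero i)⟩, ?_⟩
  have hfib : ∀ a, f ⁻¹' {f a} = B a := fun a => by
    ext b
    rw [Set.mem_preimage, Set.mem_singleton_iff, hfB]
    exact ⟨fun h => h ▸ ha b, fun h => hBeq _ (hB a) _ h⟩
  ext b
  constructor
  · intro hb
    obtain ⟨a, hab⟩ := hne b hb
    exact ⟨f a, (hfib a).trans (hBeq b hb a hab)⟩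
  · rintro ⟨j, rfl⟩
    have := hfib (Nat.nth p j)
    rw [hfnth] at this
    change f ⁻¹' {j} ∈ X
    exact this ▸ hB _

theorem coarser_iff {P Q : Set (Set ℕ)} (hP : pdom P = Set.univ) (hQ : InfPart Q) :
    Coarser P Q ↔ ∀ p ∈ P, ∀ q ∈ Q, ∀ a ∈ q, a ∈ p → q ⊆ p := by
  obtain ⟨⟨-, hdisj⟩, hdom, -⟩ := hQ
  simp only [Coarser, hP, hdom, Set.inter_univ]
  refine forall₂_congr fun p _ => ⟨?_, fun h => ⟨{q | q ∈ Q ∧ q ⊆ p}, fun q hq => hq.1, ?_⟩⟩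
  · rintro ⟨S, hS, rfl⟩ q hq a haq hap
    obtain ⟨q', hq', haq'⟩ := Set.mem_iUnion₂.1 hap
    have : q = q' := by
      by_contra hne
      exact Set.disjoint_left.1 (hdisj q hq q' (hS hq') hne) haq haq'
    exact fun b hb => Set.mem_iUnion₂.2 ⟨q', hq', this ▸ hb⟩
  · refine Set.Subset.antisymm (fun a ha => ?_) (Set.iUnion₂_subset fun q hq => hq.2)
    obtain ⟨q, hq, haq⟩ : a ∈ pdom Q := hdom ▸ Set.mem_univ a
    exact Set.mem_iUnion₂.2 ⟨q, ⟨hq, h q hq a haq ha⟩, haq⟩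

theorem coarser_fibres_comp {f : ℕ → ℕ} (g : ℕ → ℕ) {X : Set (Set ℕ)} (hX : InfPart X)
    (h : Coarser (fibres f) X) : Coarser (fibres (g ∘ f)) X := by
  rw [coarser_iff (pdom_fibres _) hX] at h ⊢
  rintro _ ⟨n, rfl⟩ q hq a haq hap b hb
  have : f b = f a := h _ ⟨f a, rfl⟩ q hq a haq rfl hb
  change g (f b) = n
  rw [this]
  exact hap

/-- A partition coarser than the fibres of `f` is given by a function that factors through `f`. -/
theorem RigidFix.exists_comp_of_coarser {f y : ℕ → ℕ} (hf : RigidFix 0 f) (hy : RigidFix 0 y)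
    (h : Coarser (fibres y) (fibres f)) : ∃ g, RigidFix 0 g ∧ y = g ∘ f := by
  rw [coarser_iff (pdom_fibres _) hf.infPart_fibres] at h
  have hker : ∀ a b, f a = f b → y a = y b := fun a b hab =>
    h _ ⟨y b, rfl⟩ _ ⟨f b, rfl⟩ b rfl rfl hab
  choose s hs hcut using hf.exists_first
  have hy_eq : y = (y ∘ s) ∘ f := funext fun a => hker _ _ (hs (f a)).symm
  refine ⟨y ∘ s, ⟨fun i j hj => ?_, fun j => ?_, fun i hi => absurd hi (Nat.not_lt_zero i)⟩, hy_eq⟩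
  · obtain ⟨b, hb, rfl⟩ := hy.init _ j hj
    exact ⟨f b, (hcut i).lt b hb, (congrFun hy_eq b).symm⟩
  · obtain ⟨b, rfl⟩ := hy.surj j
    exact ⟨f b, (congrFun hy_eq b).symm⟩

theorem RigidFix.fix_of_injOn {g : ℕ → ℕ} (hg : RigidFix 0 g) {m : ℕ}
    (hinj : ∀ i < m, ∀ j < m, g i = g j → i = j) : RigidFix m g := by
  refine ⟨hg.init, hg.surj, fun i => ?_⟩
  induction i using Nat.strong_induction_on with
  | _ i ih =>
    intro hi
    rcases (hg.apply_le i).lt_or_eq with h | h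
    · exact hinj _ (h.trans hi) _ hi (ih _ h (h.trans hi))
    · exact h

/-- The point of the space of infinite partitions given by a rigid surjection. -/
def RigidFix.toPart {f : ℕ → ℕ} (hf : RigidFix 0 f) : PartNat := ⟨fibres f, hf.infPart_fibres⟩

theorem PartNat.exists_toPart (Y : PartNat) : ∃ (f : ℕ → ℕ) (hf : RigidFix 0 f), hf.toPart = Y := by
  obtain ⟨f, hf, e⟩ := Y.2.exists_fibres
  exact ⟨f, hf, Subtype.ext e.symm⟩

/-! ### The dual Ellentuck topology in terms of rigid surjections -/

theorem exists_forall_toPart_mem {U : Set PartNat} (hU : @IsOpen PartNat dualEllentuckTopology U)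
    {f : ℕ → ℕ} (hf : RigidFix 0 f) (hfU : hf.toPart ∈ U) :
    ∃ m, ∀ g (hg : RigidFix m g), (hg.zero.comp hf).toPart ∈ U := by
  induction hU with
  | basic S hS =>
    obtain ⟨s, X, ⟨-, n, hn⟩, hX, rfl⟩ := hS
    obtain ⟨-, hseg, hcoarse⟩ := hfU
    refine ⟨n, fun g hg => ⟨(hg.zero.comp hf).infPart_fibres, fun p hp => ?_,
      coarser_fibres_comp g hX hcoarse⟩⟩
    obtain ⟨_, ⟨j, rfl⟩, e⟩ := hseg p hp
    refine ⟨_, ⟨j, rfl⟩, e.trans ?_⟩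
    ext a
    refine and_congr_left fun ha => ?_
    rw [hn] at ha
    have : g (f a) = f a := hg.fix _ ((hf.apply_le a).trans_lt ha)
    change f a = j ↔ g (f a) = j
    rw [this]
  | univ => exact ⟨0, fun _ _ => trivial⟩
  | inter S T _ _ ihS ihT =>
    obtain ⟨m, hm⟩ := ihS hfU.1
    obtain ⟨k, hk⟩ := ihT hfU.2
    exact ⟨max m k, fun g hg =>
      ⟨hm g (hg.mono (le_max_left _ _)), hk g (hg.mono (le_max_right _ _))⟩⟩
  | sUnion C _ ih =>
    obtain ⟨S, hS, hfS⟩ := hfU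
    obtain ⟨m, hm⟩ := ih S hS hfS
    exact ⟨m, fun g hg => ⟨S, hS, hm g hg⟩⟩

theorem exists_isOpen_toPart_mem (m : ℕ) {f : ℕ → ℕ} (hf : RigidFix 0 f) :
    ∃ V : Set PartNat, @IsOpen PartNat dualEllentuckTopology V ∧ hf.toPart ∈ V ∧
      ∀ Y ∈ V, ∃ (g : ℕ → ℕ) (hg : RigidFix m g), Y = (hg.zero.comp hf).toPart := by
  obtain ⟨n, -, hcut⟩ := hf.exists_first m
  let s : Set (Set ℕ) := {b | ∃ j < m, b = f ⁻¹' {j} ∩ Set.Iio n}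
  have hdom : pdom s = Set.Iio n := by
    ext a
    constructor
    · rintro ⟨_, ⟨j, -, rfl⟩, ha⟩
      exact ha.2
    · exact fun ha => ⟨_, ⟨f a, hcut.lt a ha, rfl⟩, rfl, ha⟩
  have hs : FinPart s := by
    refine ⟨⟨?_, ?_⟩, n, hdom⟩
    · rintro _ ⟨j, hj, rfl⟩
      obtain ⟨i, hi, e⟩ := hcut.hit j hj
      exact ⟨i, e, hi⟩
    · rintro _ ⟨i, -, rfl⟩ _ ⟨j, -, rfl⟩ hne
      refine Set.disjoint_left.2 fun a ha hb => hne ?_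
      have ha' : f a = i := ha.1
      have hb' : f a = j := hb.1
      rw [← ha', ← hb']
  refine ⟨{Y | Y.1 ∈ EllNbhd s (fibres f)},
    TopologicalSpace.isOpen_generateFrom_of_mem ⟨s, _, hs, hf.infPart_fibres, rfl⟩,
    ⟨hf.infPart_fibres, ?_, ?_⟩, ?_⟩
  · rintro _ ⟨j, -, rfl⟩
    exact ⟨_, ⟨j, rfl⟩, by rw [hdom]⟩
  · change Coarser (fibres f) (fibres f)
    rw [coarser_iff (pdom_fibres _) hf.infPart_fibres]
    rintro _ ⟨i, rfl⟩ _ ⟨j, rfl⟩ a ha hb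
    have ha' : f a = j := ha
    have hb' : f a = i := hb
    rw [← ha', ← hb']
  · rintro Y ⟨-, hseg, hcoarse⟩
    obtain ⟨y, hy, rfl⟩ := Y.exists_toPart
    obtain ⟨g, hg, rfl⟩ := hf.exists_comp_of_coarser hy hcoarse
    refine ⟨g, hg.fix_of_injOn fun i hi j hj hij => ?_, rfl⟩
    obtain ⟨a, ha, rfl⟩ := hcut.hit i hi
    obtain ⟨b, hb, rfl⟩ := hcut.hit j hj
    obtain ⟨_, ⟨k, rfl⟩, e⟩ := hseg _ ⟨f a, hi, rfl⟩
    rw [hdom] at e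
    have hak : g (f a) = k := ((Set.ext_iff.1 e a).1 ⟨rfl, ha⟩).1
    have hbk : b ∈ f ⁻¹' {f a} ∩ Set.Iio n :=
      (Set.ext_iff.1 e b).2 ⟨hij.symm.trans hak, hb⟩
    exact hbk.1.symm

theorem isDenseOpen_toPart_mem {D : Set PartNat} (hD : @IsOpen PartNat dualEllentuckTopology D)
    (hdense : @Dense _ dualEllentuckTopology D) :
    IsDenseOpen fun f => ∀ hf : RigidFix 0 f, hf.toPart ∈ D := by
  refine ⟨fun f hf hfD => ?_, fun m f hf => ?_⟩
  · obtain ⟨m, hm⟩ := exists_forall_toPart_mem hD hf (hfD hf)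
    exact ⟨m, fun g hg _ => hm g hg⟩
  · obtain ⟨V, hV, hfV, hVsub⟩ := exists_isOpen_toPart_mem m hf
    let _ := dualEllentuckTopology
    obtain ⟨Y, hYV, hYD⟩ := hdense.inter_open_nonempty V hV ⟨_, hfV⟩
    obtain ⟨g, hg, rfl⟩ := hVsub Y hYV
    exact ⟨g, hg, fun _ => hYD⟩

theorem isNowhereDense_of_isMeagre {A : Set PartNat}
    (hA : @IsMeagre PartNat dualEllentuckTopology A) :
    @IsNowhereDense PartNat dualEllentuckTopology A := by
  let _ := dualEllentuckTopology
  obtain ⟨S, hS, hcount, hsub⟩ := isMeagre_iff_countable_union_isNowhereDense.1 hA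
  obtain ⟨N, hN⟩ := (hcount.insert ∅).exists_eq_range (Set.insert_nonempty _ _)
  have hNd : ∀ n, IsNowhereDense (N n) := fun n => by
    rcases (hN ▸ Set.mem_range_self n : N n ∈ insert ∅ S) with h | h
    · rw [h]
      exact isNowhereDense_empty
    · exact hS _ h
  have hdense : ∀ n, IsDenseOpen fun f => ∀ hf : RigidFix 0 f, hf.toPart ∈ (closure (N n))ᶜ :=
    fun n => isDenseOpen_toPart_mem (isClosed_closure (s := N n)).isOpen_compl
      (interior_eq_empty_iff_dense_compl.1 (hNd n))
  refine Set.eq_empty_of_forall_notMem fun Y hY => ?_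
  obtain ⟨f, hf, rfl⟩ := Y.exists_toPart
  obtain ⟨m, hm⟩ := exists_forall_toPart_mem isOpen_interior hf hY
  obtain ⟨h, hh, H⟩ := IsDenseOpen.exists_forall hdense m hf
  obtain ⟨V, hV, hhV, hVsub⟩ := exists_isOpen_toPart_mem m (hh.zero.comp hf)
  obtain ⟨Z, hZV, hZA⟩ := mem_closure_iff.1 (interior_subset (hm h hh)) V hV hhV
  obtain ⟨g, hg, rfl⟩ := hVsub Z hZV
  obtain ⟨t, ht, hZt⟩ := hsub hZA
  obtain ⟨n, rfl⟩ : t ∈ Set.range N := hN ▸ Set.mem_insert_of_mem _ ht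
  exact H g hg n _ (subset_closure hZt)

/-- In the dual Ellentuck topology every meager set is nowhere dense,
and consequently no nonempty open set is meager. -/
theorem dual_ellentuck_baire :
    (∀ A : Set PartNat,
      @IsMeagre PartNat dualEllentuckTopology A →
        @IsNowhereDense PartNat dualEllentuckTopology A) ∧
    (∀ U : Set PartNat,
      @IsOpen PartNat dualEllentuckTopology U → U.Nonempty →
        ¬ @IsMeagre PartNat dualEllentuckTopology U) := by
  refine ⟨fun A hA => isNowhereDense_of_isMeagre hA, fun U hU hne hmeagre => hne.ne_empty ?_⟩
  let _ := dualEllentuckTopology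
  exact Set.subset_eq_empty (interior_maximal subset_closure hU)
    (isNowhereDense_of_isMeagre hmeagre)

end DualRamsey
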